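/- Let P be a Metropolis–Hastings type kernel, reversible with respect to μ, with μ not concentrated at a single point, and assume P is ψ-irreducible. Then ϱ(x)>0 for every x∈X. Moreover, the jump chain (X̃_i,τ_i)_{i≥1} associated with a Markov chain (X_i)_{i≥1} evolving under P — where (X̃_i) are the successive distinct values, i.e. the accepted proposals, and (τ_i) the sojourn times, so that X̃₁=X₁=⋯=X_{τ₁}, X̃₂=X_{τ₁+1}=⋯=X_{τ₁+τ₂}, etc., with X̃_{i+1}≠X̃_i — is itself a Markov chain on X×{1,2,…} with transition kernel P̄{(x,τ),(dy,{ζ})} = P̃(x,dy)·G(ζ;ϱ(y)), and P̄ is reversible with respect to the probability measure μ̄(dx,{τ}) = μ̃(dx)·G(τ;ϱ(x)), where G(k;υ)=υ(1−υ)^{k−1} denotes the geometric distribution with parameter υ; in particular P̃ is reversible with respect to μ̃. -/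

import Mathlib

open MeasureTheory ProbabilityTheory Filter Real
open scoped ENNReal NNReal

noncomputable section

variable {X : Type*} [MeasurableSpace X]

/-- `n`-fold iterate of a Markov kernel. -/
def kpow (kappa : Kernel X X) : ℕ → Kernel X X
  | 0 => Kernel.id
  | n + 1 => (kpow kappa n).comp kappa

/-- Action of a kernel on a function: `(Pi f)(x) = ∫ f(y) Pi(x,dy)`. -/
def kApp (kappa : Kernel X X) (f : X → ℝ) (x : X) : ℝ := ∫ y, f y ∂(kappa x)

/-- Reversibility of a kernel with respect to a measure: the measure `mu(dx) Pi(x,dy)`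
on `X × X` is invariant under the swap `(x,y) ↦ (y,x)`. -/
def Reversible (kappa : Kernel X X) (mu : Measure X) : Prop :=
  (mu.compProd kappa).map Prod.swap = mu.compProd kappa

/-- Irreducibility with respect to a given nonzero σ-finite measure `psi`: every set of
positive `psi`-measure is reached from every point with positive probability in finitely
many steps. -/
def IrreducibleWrt (kappa : Kernel X X) (psi : Measure X) : Prop :=
  psi ≠ 0 ∧ SigmaFinite psi ∧
    ∀ x : X, ∀ A : Set X, MeasurableSet A → 0 < psi A → ∃ n : ℕ, 1 ≤ n ∧ 0 < (kpow kappa n) x A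

/-- `ψ`-irreducibility: irreducible with respect to some nonzero σ-finite measure. -/
def PsiIrreducible (kappa : Kernel X X) : Prop := ∃ psi : Measure X, IrreducibleWrt kappa psi

/-- A kernel is ergodic w.r.t. `mu` if it is `mu`-invariant and `ψ`-irreducible. -/
def ErgodicK (kappa : Kernel X X) (mu : Measure X) : Prop :=
  mu.bind (fun x => kappa x) = mu ∧ PsiIrreducible kappa

/-- The centered version `h̄ = h - mu(h)` of a function. -/
def ctr (mu : Measure X) (h : X → ℝ) : X → ℝ := fun x => h x - ∫ y, h y ∂mu

/-- The variance `mu(h̄²)`. -/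
def varμ (mu : Measure X) (h : X → ℝ) : ℝ := ∫ x, (ctr mu h x) ^ 2 ∂mu

/-- Lag-`n` autocorrelation `φₙ(h,Pi) = ⟨h̄, Piⁿ h̄⟩_mu / mu(h̄²)`. -/
def acf (kappa : Kernel X X) (mu : Measure X) (h : X → ℝ) (n : ℕ) : ℝ :=
  (∫ x, ctr mu h x * kApp (kpow kappa n) (ctr mu h) x ∂mu) / varμ mu h

/-- Partial sums defining the inefficiency `IF(h,Pi) = 1 + 2 ∑_{n≥1} φₙ(h,Pi)`. -/
def ifPartial (kappa : Kernel X X) (mu : Measure X) (h : X → ℝ) (N : ℕ) : ℝ :=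
  1 + 2 * ∑ k ∈ Finset.range N, acf kappa mu h (k + 1)

/-- The inefficiency `IF(h,Pi)` equals the real number `L` (in particular it is finite). -/
def HasIF (kappa : Kernel X X) (mu : Measure X) (h : X → ℝ) (L : ℝ) : Prop :=
  Tendsto (ifPartial kappa mu h) atTop (nhds L)

/-- The inefficiency `IF(h,Pi)` as a possibly infinite limit in the extended reals. -/
def HasIFE (kappa : Kernel X X) (mu : Measure X) (h : X → ℝ) (L : EReal) : Prop :=
  Tendsto (fun N => ((ifPartial kappa mu h N : ℝ) : EReal)) atTop (nhds L)

/-- The law of a Markov chain `(X_i)_{i≥0}` with transition kernel `kappa` and initial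
distribution `nu`, encoded through its finite-dimensional distributions. -/
def IsMarkovTraj (kappa : Kernel X X) (nu : Measure X) (rho : Measure (ℕ → X)) : Prop :=
  IsProbabilityMeasure rho ∧ rho.map (fun om => om 0) = nu ∧
    ∀ n : ℕ, rho.map (fun om => ((fun i : Fin (n + 1) => om i), om (n + 1)))
      = (rho.map (fun om => (fun i : Fin (n + 1) => om i))).compProd
          (kappa.comap (fun v : Fin (n + 1) → X => v (Fin.last n)) (measurable_pi_apply _))

/-- Acceptance rate `ϱ(x) = ∫ q(x,dy) α(x,y)`. -/
def rhoMH (q : Kernel X X) (alpha : X → X → ℝ) (x : X) : ℝ := ∫ y, alpha x y ∂(q x)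

/-- The Metropolis–Hastings type kernel `P(x,dy) = q(x,dy) α(x,y) + {1 - ϱ(x)} δ_x(dy)`,
expressed as the measure it assigns to each starting point. -/
def mhMeasure (q : Kernel X X) (alpha : X → X → ℝ) (x : X) : Measure X :=
  (q x).withDensity (fun y => ENNReal.ofReal (alpha x y)) +
    ENNReal.ofReal (1 - rhoMH q alpha x) • Measure.dirac x

/-- The jump kernel `P̃(x,dy) = q(x,dy) α(x,y) / ϱ(x)`, expressed as the measure it
assigns to each starting point. -/
def jumpMeasure (q : Kernel X X) (alpha : X → X → ℝ) (x : X) : Measure X :=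
  (ENNReal.ofReal (rhoMH q alpha x))⁻¹ • (q x).withDensity (fun y => ENNReal.ofReal (alpha x y))

/-- The geometric distribution `G(·;υ)` on `{1,2,…}`: mass `υ(1-υ)^{k-1}` at `k ≥ 1`. -/
def geomMeasure (u : ℝ) : Measure ℕ :=
  Measure.sum (fun k : ℕ => (ENNReal.ofReal (u * (1 - u) ^ k)) • Measure.dirac (k + 1))

/-- The probability measure `μ̃(dx) = μ(dx) ϱ(x) / μ(ϱ)`. -/
def muTilde (mu : Measure X) (rho : X → ℝ) : Measure X :=
  (ENNReal.ofReal (∫ x, rho x ∂mu))⁻¹ • mu.withDensity (fun x => ENNReal.ofReal (rho x))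

/-- The probability measure `μ̄(dx,{τ}) = μ̃(dx) G(τ;ϱ(x))` on `X × ℕ`. -/
def muBar (mu : Measure X) (rho : X → ℝ) : Measure (X × ℕ) :=
  (muTilde mu rho).bind (fun x => (Measure.dirac x).prod (geomMeasure (rho x)))

/-- Successive jump times of a trajectory: `jumpIdx ω 0 = 0` and `jumpIdx ω (k+1)` is the
first time after `jumpIdx ω k` at which the trajectory changes value. -/
def jumpIdx (om : ℕ → X) : ℕ → ℕ
  | 0 => 0
  | k + 1 => sInf {m | jumpIdx om k < m ∧ om m ≠ om (jumpIdx om k)}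

/-- The jump chain of a trajectory: the successive distinct values (accepted proposals)
together with the associated sojourn times. -/
def jumpTraj (om : ℕ → X) (k : ℕ) : X × ℕ :=
  (om (jumpIdx om k), jumpIdx om (k + 1) - jumpIdx om k)

/-- The Markov property of a trajectory law with respect to a transition kernel
(with unspecified initial distribution). -/
def HasMarkovProp {Y : Type*} [MeasurableSpace Y] (kappa : Kernel Y Y)
    (rho : Measure (ℕ → Y)) : Prop :=
  ∀ n : ℕ, rho.map (fun om => ((fun i : Fin (n + 1) => om i), om (n + 1)))
    = (rho.map (fun om => (fun i : Fin (n + 1) => om i))).compProd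
        (kappa.comap (fun v : Fin (n + 1) → Y => v (Fin.last n)) (measurable_pi_apply _))

/-! ### Jump times of a trajectory -/

section JumpTimes

variable {E : Type*}

/-- The trajectory performs at least `n` genuine jumps. -/
def JumpsUpTo (n : ℕ) (om : ℕ → E) : Prop := ∀ k < n, jumpIdx om k < jumpIdx om (k + 1)

/-- The trajectory keeps the value it has at time `s` during the next `k` steps. -/
def StaysFor (s k : ℕ) (om : ℕ → E) : Prop := ∀ j ≤ k, om (s + j) = om s

theorem jumpIdx_succ_eq_iff {om : ℕ → E} {k m : ℕ} (hm : jumpIdx om k < m) :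
    jumpIdx om (k + 1) = m ↔
      om m ≠ om (jumpIdx om k) ∧ ∀ j, jumpIdx om k < j → j < m → om j = om (jumpIdx om k) := by
  rw [jumpIdx]
  constructor
  · intro h
    have hne : {i | jumpIdx om k < i ∧ om i ≠ om (jumpIdx om k)}.Nonempty := by
      apply Nat.nonempty_of_pos_sInf
      omega
    have hmem := Nat.sInf_mem hne
    rw [h] at hmem
    refine ⟨hmem.2, fun j hj hjm => ?_⟩
    by_contra hcon
    exact Nat.notMem_of_lt_sInf (hjm.trans_eq h.symm) ⟨hj, hcon⟩
  · rintro ⟨hne, hall⟩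
    apply le_antisymm
    · exact Nat.sInf_le ⟨hm, hne⟩
    · refine le_csInf ⟨m, hm, hne⟩ fun j hj => ?_
      by_contra! hlt
      exact hj.2 (hall j hj.1 hlt)

theorem jumpIdx_succ_eq_add_iff {om : ℕ → E} {k t : ℕ} :
    jumpIdx om (k + 1) = jumpIdx om k + (t + 1) ↔
      StaysFor (jumpIdx om k) t om ∧
        om (jumpIdx om k + t + 1) ≠ om (jumpIdx om k + t) := by
  rw [jumpIdx_succ_eq_iff (m := jumpIdx om k + (t + 1)) (by omega)]
  constructor
  · rintro ⟨h1, h2⟩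
    have hst : StaysFor (jumpIdx om k) t om := by
      intro j hj
      rcases Nat.eq_zero_or_pos j with rfl | hpos
      · rfl
      · exact h2 _ (by omega) (by omega)
    refine ⟨hst, ?_⟩
    rw [hst t le_rfl]
    exact h1
  · rintro ⟨h1, h2⟩
    rw [h1 t le_rfl] at h2
    refine ⟨h2, fun j hj hjt => ?_⟩
    obtain ⟨i, rfl⟩ := Nat.exists_eq_add_of_lt hj
    exact h1 (i + 1) (by omega)

theorem jumpIdx_lt_succ_of_ne {om : ℕ → E} {k m : ℕ} (hm : jumpIdx om k < m)
    (hne : om m ≠ om (jumpIdx om k)) : jumpIdx om k < jumpIdx om (k + 1) := by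
  rw [jumpIdx]
  exact (Nat.sInf_mem (s := {i | jumpIdx om k < i ∧ om i ≠ om (jumpIdx om k)}) ⟨m, hm, hne⟩).1

theorem JumpsUpTo.mono {om : ℕ → E} {k n : ℕ} (h : JumpsUpTo n om) (hk : k ≤ n) :
    JumpsUpTo k om := fun j hj => h j (hj.trans_le hk)

theorem JumpsUpTo.jumpIdx_le {om : ℕ → E} {k n : ℕ} (h : JumpsUpTo n om) (hk : k ≤ n) :
    jumpIdx om k ≤ jumpIdx om n := by
  induction n, hk using Nat.le_induction with
  | base => rfl
  | succ n hk ih =>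
    exact (ih (h.mono n.le_succ)).trans (h n n.lt_succ_self).le

theorem JumpsUpTo.jumpIdx_congr {om om' : ℕ → E} {n : ℕ} (h : JumpsUpTo n om)
    (hag : ∀ i ≤ jumpIdx om n, om i = om' i) {k : ℕ} (hk : k ≤ n) :
    jumpIdx om' k = jumpIdx om k := by
  induction k with
  | zero => rfl
  | succ k ih =>
    have hS := ih (by omega)
    have hlt := h k (by omega)
    have hle := h.jumpIdx_le hk
    obtain ⟨h1, h2⟩ := (jumpIdx_succ_eq_iff hlt).1 rfl
    rw [jumpIdx_succ_eq_iff (hS ▸ hlt), hS, ← hag _ hle, ← hag _ (hlt.le.trans hle)]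
    refine ⟨h1, fun j hj hjm => ?_⟩
    rw [← hag _ (hjm.le.trans hle)]
    exact h2 j hj hjm

theorem JumpsUpTo.congr {om om' : ℕ → E} {n : ℕ} (h : JumpsUpTo n om)
    (hag : ∀ i ≤ jumpIdx om n, om i = om' i) : JumpsUpTo n om' := by
  intro k hk
  rw [h.jumpIdx_congr hag hk.le, h.jumpIdx_congr hag hk]
  exact h k hk

/-- A trajectory that is never constant from some time on has infinitely many jumps. -/
theorem jumpsUpTo_of_not_staysFor {om : ℕ → E} (h : ∀ s, ∃ k, ¬ StaysFor s k om) (n : ℕ) :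
    JumpsUpTo n om := by
  intro k _
  obtain ⟨m, hm⟩ := h (jumpIdx om k)
  simp only [StaysFor, not_forall] at hm
  obtain ⟨j, -, hj⟩ := hm
  refine jumpIdx_lt_succ_of_ne (m := jumpIdx om k + j) ?_ hj
  rcases Nat.eq_zero_or_pos j with rfl | hpos
  · exact absurd rfl hj
  · omega

end JumpTimes

theorem measurable_nat_sInf {α : Type*} [MeasurableSpace α] {p : α → ℕ → Prop}
    (hp : ∀ m, MeasurableSet {a | p a m}) : Measurable fun a => sInf {m | p a m} := by
  refine measurable_to_countable' fun j => ?_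
  have key : (fun a => sInf {m | p a m}) ⁻¹' {j} =
      ({a | p a j} ∩ ⋂ i, ⋂ (_ : i < j), {a | p a i}ᶜ) ∪
        ({_a | j = 0} ∩ ⋂ i, {a | p a i}ᶜ) := by
    ext a
    simp only [Set.mem_preimage, Set.mem_singleton_iff, Set.mem_union, Set.mem_inter_iff,
      Set.mem_iInter, Set.mem_compl_iff, Set.mem_ofPred_eq]
    constructor
    · rintro rfl
      rcases Set.eq_empty_or_nonempty {m | p a m} with he | hne
      · right
        rw [he]
        exact ⟨Nat.sInf_empty, fun i hi => (Set.eq_empty_iff_forall_notMem.1 he i) hi⟩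
      · exact Or.inl ⟨Nat.sInf_mem hne, fun i hi => Nat.notMem_of_lt_sInf hi⟩
    · rintro (⟨h1, h2⟩ | ⟨rfl, h⟩)
      · refine le_antisymm (Nat.sInf_le h1) (le_csInf ⟨j, h1⟩ fun i hi => ?_)
        by_contra! hlt
        exact h2 i hlt hi
      · have he : {m | p a m} = ∅ := Set.eq_empty_iff_forall_notMem.2 h
        rw [he, Nat.sInf_empty]
  rw [key]
  refine ((hp j).inter (.iInter fun i => .iInter fun _ => (hp i).compl)).union
    ((MeasurableSet.const _).inter (.iInter fun i => (hp i).compl))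

theorem measurable_eval_comp {α : Type*} [MeasurableSpace α] {f : α → ℕ → X} {N : α → ℕ}
    (hf : Measurable f) (hN : Measurable N) : Measurable fun a => f a (N a) := by
  have h : Measurable fun p : ℕ × (ℕ → X) => p.2 p.1 :=
    measurable_from_prod_countable_right fun m => measurable_pi_apply m
  exact h.comp (hN.prodMk hf)

section MeasurableEq

variable [MeasurableEq X]

theorem measurable_jumpIdx (k : ℕ) : Measurable fun om : ℕ → X => jumpIdx om k := by
  induction k with
  | zero => exact measurable_const
  | succ k ih =>
    simp only [jumpIdx]
    refine measurable_nat_sInf fun m => MeasurableSet.inter ?_ ?_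
    · exact measurableSet_lt ih measurable_const
    · exact (measurableSet_eq_fun (measurable_pi_apply m)
        (measurable_eval_comp measurable_id ih)).compl

theorem measurable_jumpTraj : Measurable fun om : ℕ → X => jumpTraj om := by
  refine measurable_pi_lambda _ fun k => ?_
  exact (measurable_eval_comp measurable_id (measurable_jumpIdx k)).prodMk
    ((measurable_jumpIdx (k + 1)).sub (measurable_jumpIdx k))

theorem measurableSet_jumpsUpTo (n : ℕ) : MeasurableSet {om : ℕ → X | JumpsUpTo n om} := by
  have : {om : ℕ → X | JumpsUpTo n om} =
      ⋂ k, ⋂ (_ : k < n), {om | jumpIdx om k < jumpIdx om (k + 1)} := by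
    ext om
    simp [JumpsUpTo]
  rw [this]
  exact .iInter fun k => .iInter fun _ =>
    measurableSet_lt (measurable_jumpIdx k) (measurable_jumpIdx (k + 1))

theorem measurableSet_staysFor (s k : ℕ) : MeasurableSet {om : ℕ → X | StaysFor s k om} := by
  have : {om : ℕ → X | StaysFor s k om} = ⋂ j, ⋂ (_ : j ≤ k), {om | om (s + j) = om s} := by
    ext om
    simp [StaysFor]
  rw [this]
  exact .iInter fun j => .iInter fun _ =>
    measurableSet_eq_fun (measurable_pi_apply _) (measurable_pi_apply _)

end MeasurableEq

/-! ### The Markov property in functional form -/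

section MarkovProperty

variable {P : Kernel X X} [IsMarkovKernel P] {rho : Measure (ℕ → X)} [IsProbabilityMeasure rho]

theorem HasMarkovProp.lintegral (h : HasMarkovProp P rho) (s : ℕ) {f : (ℕ → X) → X → ℝ≥0∞}
    (hf : Measurable (Function.uncurry f))
    (hdep : ∀ om om' : ℕ → X, (∀ i ≤ s, om i = om' i) → f om = f om') :
    ∫⁻ om, f om (om (s + 1)) ∂rho = ∫⁻ om, ∫⁻ y, f om y ∂P (om s) ∂rho := by
  let e : (Fin (s + 1) → X) → ℕ → X := fun v i => v ⟨min i s, by omega⟩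
  have he : Measurable e := measurable_pi_lambda _ fun i => measurable_pi_apply _
  have hres : Measurable fun om : ℕ → X => fun i : Fin (s + 1) => om i :=
    measurable_pi_lambda _ fun i => measurable_pi_apply _
  have hfe : ∀ om : ℕ → X, f (e fun i : Fin (s + 1) => om i) = f om := fun om =>
    hdep _ _ fun i hi => by simp [e, hi]
  have hF : Measurable fun p : (Fin (s + 1) → X) × X => f (e p.1) p.2 :=
    hf.comp ((he.comp measurable_fst).prodMk measurable_snd)
  have key := congrArg (fun m => ∫⁻ p, f (e p.1) p.2 ∂m) (h s)
  rw [lintegral_map hF (hres.prodMk (measurable_pi_apply _)), Measure.lintegral_compProd hF,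
    lintegral_map _ hres] at key
  · simpa [hfe, Kernel.comap_apply] using key
  · exact hF.lintegral_kernel_prod_right'

variable [MeasurableEq X]

theorem Kernel.measurable_apply_singleton_self : Measurable fun x => P x {x} := by
  have := Kernel.measurable_kernel_prodMk_left (κ := P)
    (measurableSet_diagonal : MeasurableSet (Set.diagonal X))
  convert this using 3 with x
  ext y
  simp [eq_comm]

theorem Kernel.measurable_apply_compl_singleton_self :
    Measurable fun x => P x {x}ᶜ := by
  simp only [prob_compl_eq_one_sub (measurableSet_singleton _)]
  exact measurable_const.sub Kernel.measurable_apply_singleton_self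

theorem measurable_setLIntegral_compl_singleton {α : Type*} [MeasurableSpace α] {e : α → X}
    (he : Measurable e) {f : α → X → ℝ≥0∞} (hf : Measurable (Function.uncurry f)) :
    Measurable fun a => ∫⁻ y in {e a}ᶜ, f a y ∂P (e a) := by
  have hms : MeasurableSet {p : α × X | p.2 ≠ e p.1} :=
    (measurableSet_eq_fun measurable_snd (he.comp measurable_fst)).compl
  have := (hf.indicator hms).lintegral_kernel_prod_right' (κ := P.comap e he)
  convert this using 2 with a
  rw [← lintegral_indicator (measurableSet_singleton _).compl]
  rfl

theorem HasMarkovProp.lintegral_staysFor (h : HasMarkovProp P rho) (s k : ℕ)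
    {f : (ℕ → X) → ℝ≥0∞} (hf : Measurable f)
    (hdep : ∀ om om' : ℕ → X, (∀ i ≤ s, om i = om' i) → f om = f om') :
    ∫⁻ om, {om | StaysFor s k om}.indicator f om ∂rho =
      ∫⁻ om, P (om s) {om s} ^ k * f om ∂rho := by
  classical
  induction k generalizing f with
  | zero =>
    have : {om : ℕ → X | StaysFor s 0 om} = Set.univ := by
      ext om
      simp [StaysFor]
    simp [this]
  | succ k ih =>
    have hP : Measurable fun om : ℕ → X => P (om s) {om s} :=
      Kernel.measurable_apply_singleton_self.comp (measurable_pi_apply s)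
    let F : (ℕ → X) → X → ℝ≥0∞ := fun om y =>
      {p : (ℕ → X) × X | StaysFor s k p.1 ∧ p.2 = p.1 s}.indicator (fun p => f p.1) (om, y)
    have hF : Measurable (Function.uncurry F) :=
      (hf.comp measurable_fst).indicator ((measurable_fst (measurableSet_staysFor s k)).inter
        (measurableSet_eq_fun measurable_snd ((measurable_pi_apply s).comp measurable_fst)))
    have hFdep : ∀ om om' : ℕ → X, (∀ i ≤ s + k, om i = om' i) → F om = F om' := by
      intro om om' hag
      have h1 : StaysFor s k om ↔ StaysFor s k om' := by
        refine forall₂_congr fun j hj => ?_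
        rw [hag (s + j) (by omega), hag s (by omega)]
      ext y
      simp only [F, Set.indicator_apply, Set.mem_ofPred_eq, h1, hag s (by omega),
        hdep om om' fun i hi => hag i (by omega)]
    calc ∫⁻ om, {om | StaysFor s (k + 1) om}.indicator f om ∂rho
        = ∫⁻ om, F om (om (s + k + 1)) ∂rho := by
          congr with om
          have : StaysFor s (k + 1) om ↔ StaysFor s k om ∧ om (s + k + 1) = om s := by
            constructor
            · exact fun h => ⟨fun j hj => h j (by omega), h (k + 1) le_rfl⟩
            · rintro ⟨h1, h2⟩ j hj
              rcases Nat.lt_or_eq_of_le hj with hj | rfl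
              · exact h1 j (by omega)
              · exact h2
          simp only [F, Set.indicator_apply, Set.mem_ofPred_eq, this]
      _ = ∫⁻ om, ∫⁻ y, F om y ∂P (om (s + k)) ∂rho := h.lintegral _ hF hFdep
      _ = ∫⁻ om, {om | StaysFor s k om}.indicator (fun om => P (om s) {om s} * f om) om ∂rho := by
          congr with om
          by_cases hs : StaysFor s k om
          · have : F om = ({om s} : Set X).indicator fun _ => f om := by
              ext y
              simp [F, Set.indicator_apply, hs]
            rw [this, lintegral_indicator (measurableSet_singleton _), setLIntegral_const,
              hs k le_rfl, Set.indicator_of_mem (by exact hs), mul_comm]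
          · simp [F, hs]
      _ = ∫⁻ om, P (om s) {om s} ^ (k + 1) * f om ∂rho := by
          rw [ih (f := fun om => P (om s) {om s} * f om) (hP.mul hf) fun om om' hag => by
            rw [hag s le_rfl, hdep om om' hag]]
          simp only [pow_succ, mul_assoc]

theorem HasMarkovProp.lintegral_staysFor_and_ne (h : HasMarkovProp P rho) (s t : ℕ)
    {f : (ℕ → X) → X → ℝ≥0∞} (hf : Measurable (Function.uncurry f))
    (hdep : ∀ om om' : ℕ → X, (∀ i ≤ s, om i = om' i) → f om = f om') :
    ∫⁻ om, {om | StaysFor s t om ∧ om (s + t + 1) ≠ om (s + t)}.indicator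
        (fun om => f om (om (s + t + 1))) om ∂rho =
      ∫⁻ om, P (om s) {om s} ^ t * ∫⁻ y in {om s}ᶜ, f om y ∂P (om s) ∂rho := by
  classical
  let F : (ℕ → X) → X → ℝ≥0∞ := fun om y =>
    {p : (ℕ → X) × X | StaysFor s t p.1 ∧ p.2 ≠ p.1 s}.indicator (Function.uncurry f) (om, y)
  have hF : Measurable (Function.uncurry F) :=
    hf.indicator ((measurable_fst (measurableSet_staysFor s t)).inter
      (measurableSet_eq_fun measurable_snd ((measurable_pi_apply s).comp measurable_fst)).compl)
  have hFdep : ∀ om om' : ℕ → X, (∀ i ≤ s + t, om i = om' i) → F om = F om' := by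
    intro om om' hag
    have h1 : StaysFor s t om ↔ StaysFor s t om' := by
      refine forall₂_congr fun j hj => ?_
      rw [hag (s + j) (by omega), hag s (by omega)]
    ext y
    simp only [F, Set.indicator_apply, Set.mem_ofPred_eq, h1, hag s (by omega),
      Function.uncurry_apply_pair, hdep om om' fun i hi => hag i (by omega)]
  have hg : Measurable fun om : ℕ → X => ∫⁻ y in {om s}ᶜ, f om y ∂P (om s) :=
    measurable_setLIntegral_compl_singleton (measurable_pi_apply s) hf
  rw [← h.lintegral_staysFor s t hg fun om om' hag => by rw [hag s le_rfl, hdep om om' hag]]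
  calc _ = ∫⁻ om, F om (om (s + t + 1)) ∂rho := by
        congr with om
        simp only [F, Set.indicator_apply, Set.mem_ofPred_eq, Function.uncurry_apply_pair]
        congr 1
        refine propext (and_congr_right fun hs => ?_)
        rw [hs t le_rfl]
    _ = ∫⁻ om, ∫⁻ y, F om y ∂P (om (s + t)) ∂rho := h.lintegral _ hF hFdep
    _ = _ := by
        congr with om
        by_cases hs : StaysFor s t om
        · have : F om = ({om s}ᶜ : Set X).indicator (f om) := by
            ext y
            simp [F, Set.indicator_apply, hs]
          rw [this, lintegral_indicator (measurableSet_singleton _).compl, hs t le_rfl,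
            Set.indicator_of_mem (by exact hs)]
        · simp [F, hs]

theorem HasMarkovProp.ae_jumpsUpTo (h : HasMarkovProp P rho) (hlt : ∀ x, P x {x} < 1) (n : ℕ) :
    ∀ᵐ om ∂rho, JumpsUpTo n om := by
  have hP (s : ℕ) : Measurable fun om : ℕ → X => P (om s) {om s} :=
    Kernel.measurable_apply_singleton_self.comp (measurable_pi_apply s)
  have hs : ∀ s : ℕ, ∀ᵐ om ∂rho, ∃ k, ¬ StaysFor s k om := by
    intro s
    have hle : ∀ k, rho {om | ¬ ∃ k, ¬ StaysFor s k om} ≤ ∫⁻ om, P (om s) {om s} ^ k ∂rho := by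
      intro k
      have hk := h.lintegral_staysFor s k (f := fun _ => 1) measurable_const fun _ _ _ => rfl
      rw [lintegral_indicator (measurableSet_staysFor s k), setLIntegral_one] at hk
      simp only [mul_one] at hk
      rw [← hk]
      refine measure_mono fun om hom => ?_
      simp only [Set.mem_ofPred_eq, not_exists, not_not] at hom
      exact hom k
    have hlim : Tendsto (fun k => ∫⁻ om, P (om s) {om s} ^ k ∂rho) atTop (nhds 0) := by
      rw [← lintegral_zero (μ := rho)]
      refine tendsto_lintegral_of_dominated_convergence (fun _ => 1)
        (fun k => (hP s).pow_const k) (fun k => ?_) (by simp) ?_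
      · exact Eventually.of_forall fun om => pow_le_one₀ zero_le (hlt _).le
      · exact Eventually.of_forall fun om => ENNReal.tendsto_pow_atTop_nhds_zero_of_lt_one (hlt _)
    exact le_antisymm (ge_of_tendsto' hlim hle) zero_le
  filter_upwards [ae_all_iff.2 hs] with om hom using jumpsUpTo_of_not_staysFor hom n

theorem lintegral_eq_tsum_jumpIdx {rho : Measure (ℕ → X)} {n : ℕ}
    (hgood : ∀ᵐ om ∂rho, JumpsUpTo n om)
    {g : (ℕ → X) → ℝ≥0∞} (hg : Measurable g) :
    ∫⁻ om, g om ∂rho =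
      ∑' s, ∫⁻ om, {om | JumpsUpTo n om ∧ jumpIdx om n = s}.indicator g om ∂rho := by
  have hD (s : ℕ) : MeasurableSet {om : ℕ → X | JumpsUpTo n om ∧ jumpIdx om n = s} :=
    (measurableSet_jumpsUpTo n).inter (measurable_jumpIdx n (measurableSet_singleton s))
  rw [← lintegral_tsum fun s => (hg.indicator (hD s)).aemeasurable]
  refine lintegral_congr_ae (hgood.mono fun om hom => ?_)
  dsimp only
  rw [tsum_eq_single (jumpIdx om n)]
  · exact (Set.indicator_of_mem (by exact ⟨hom, rfl⟩) g).symm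
  · intro s hs
    exact Set.indicator_of_notMem (fun hmem => hs hmem.2.symm) _

/-- The strong Markov property at the jump times: the joint behaviour of the sojourn time and of
the next value, given the past. -/
theorem HasMarkovProp.lintegral_sojourn (h : HasMarkovProp P rho) (hlt : ∀ x, P x {x} < 1)
    (n t : ℕ) {f : (ℕ → X) → X → ℝ≥0∞} (hf : Measurable (Function.uncurry f))
    (hdep : ∀ om om' : ℕ → X, JumpsUpTo n om → (∀ i ≤ jumpIdx om n, om i = om' i) →
      f om = f om') :
    ∫⁻ om, {om | jumpIdx om (n + 1) = jumpIdx om n + (t + 1)}.indicator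
        (fun om => f om (om (jumpIdx om (n + 1)))) om ∂rho =
      ∫⁻ om, P (om (jumpIdx om n)) {om (jumpIdx om n)} ^ t *
        ∫⁻ y in {om (jumpIdx om n)}ᶜ, f om y ∂P (om (jumpIdx om n)) ∂rho := by
  classical
  have hgood := h.ae_jumpsUpTo hlt n
  have hev : Measurable fun om : ℕ → X => om (jumpIdx om n) :=
    measurable_eval_comp measurable_id (measurable_jumpIdx n)
  have hpow : Measurable fun om : ℕ → X => P (om (jumpIdx om n)) {om (jumpIdx om n)} ^ t :=
    (Kernel.measurable_apply_singleton_self.comp hev).pow_const t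
  have hint : Measurable fun om : ℕ → X =>
      ∫⁻ y in {om (jumpIdx om n)}ᶜ, f om y ∂P (om (jumpIdx om n)) :=
    measurable_setLIntegral_compl_singleton hev hf
  rw [lintegral_eq_tsum_jumpIdx hgood, lintegral_eq_tsum_jumpIdx hgood (hpow.fun_mul hint)]
  · refine tsum_congr fun s => ?_
    let D : Set (ℕ → X) := {om | JumpsUpTo n om ∧ jumpIdx om n = s}
    have hD : MeasurableSet D := (measurableSet_jumpsUpTo n).inter
      (measurable_jumpIdx n (measurableSet_singleton s))
    let F : (ℕ → X) → X → ℝ≥0∞ := fun om y => D.indicator (fun om => f om y) om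
    have hF : Measurable (Function.uncurry F) := by
      exact hf.indicator (measurable_fst hD)
    have hF_mem : ∀ om ∈ D, F om = f om := fun om hom =>
      funext fun y => Set.indicator_of_mem hom fun om => f om y
    have hF_notMem : ∀ om ∉ D, F om = fun _ => 0 := fun om hom =>
      funext fun y => Set.indicator_of_notMem hom fun om => f om y
    have hFdep : ∀ om om' : ℕ → X, (∀ i ≤ s, om i = om' i) → F om = F om' := by
      have aux : ∀ om om' : ℕ → X, (∀ i ≤ s, om i = om' i) → om ∈ D →
          om' ∈ D ∧ f om = f om' := by
        rintro om om' hag ⟨hJ, rfl⟩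
        exact ⟨⟨hJ.congr hag, hJ.jumpIdx_congr hag le_rfl⟩, hdep om om' hJ hag⟩
      intro om om' hag
      by_cases hom : om ∈ D
      · obtain ⟨h1, h2⟩ := aux om om' hag hom
        rw [hF_mem om hom, hF_mem om' h1, h2]
      · have h1 : om' ∉ D := fun h1 => hom (aux om' om (fun i hi => (hag i hi).symm) h1).1
        rw [hF_notMem om hom, hF_notMem om' h1]
    convert h.lintegral_staysFor_and_ne s t hF hFdep using 1
    · congr with om
      by_cases hom : om ∈ D
      · rw [Set.indicator_of_mem (by exact hom)]
        simp only [Set.indicator_apply, hF_mem om hom]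
        obtain ⟨-, rfl⟩ := hom
        simp only [Set.mem_ofPred_eq, ← jumpIdx_succ_eq_add_iff]
        split_ifs with hj
        · rw [hj, add_assoc]
        · rfl
      · rw [Set.indicator_of_notMem (by exact hom)]
        simp [Set.indicator_apply, hF_notMem om hom]
    · congr with om
      by_cases hom : om ∈ D
      · rw [Set.indicator_of_mem (by exact hom), hF_mem om hom]
        obtain ⟨-, rfl⟩ := hom
        rfl
      · rw [Set.indicator_of_notMem (by exact hom), hF_notMem om hom]
        simp
  · refine Measurable.indicator ?_ ?_
    · exact hf.comp (measurable_id.prodMk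
        (measurable_eval_comp measurable_id (measurable_jumpIdx (n + 1))))
    · exact measurableSet_eq_fun (measurable_jumpIdx (n + 1))
        ((measurable_jumpIdx n).add_const _)

end MarkovProperty

/-! ### The jump chain is a Markov chain -/

section JumpChain

variable [MeasurableEq X] {P : Kernel X X} [IsMarkovKernel P] {rho : Measure (ℕ → X)}
  [IsProbabilityMeasure rho]

theorem HasMarkovProp.lintegral_eq_tsum_sojourn (h : HasMarkovProp P rho)
    (hlt : ∀ x, P x {x} < 1) (n : ℕ) {g : (ℕ → X) → ℝ≥0∞} (hg : Measurable g) :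
    ∫⁻ om, g om ∂rho =
      ∑' t, ∫⁻ om, {om | jumpIdx om (n + 1) = jumpIdx om n + (t + 1)}.indicator g om ∂rho := by
  have hms (t : ℕ) : MeasurableSet {om : ℕ → X | jumpIdx om (n + 1) = jumpIdx om n + (t + 1)} :=
    measurableSet_eq_fun (measurable_jumpIdx (n + 1)) ((measurable_jumpIdx n).add_const _)
  rw [← lintegral_tsum fun t => (hg.indicator (hms t)).aemeasurable]
  refine lintegral_congr_ae ((h.ae_jumpsUpTo hlt (n + 1)).mono fun om hom => ?_)
  dsimp only
  obtain ⟨t, ht⟩ := Nat.exists_eq_add_of_lt (hom n n.lt_succ_self)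
  rw [tsum_eq_single t]
  · exact (Set.indicator_of_mem (by exact ht) g).symm
  · intro u hu
    refine Set.indicator_of_notMem (fun hmem => hu ?_) _
    have hmem : jumpIdx om (n + 1) = jumpIdx om n + (u + 1) := hmem
    omega

/-- Given the past up to the `n`-th jump and the `n`-th sojourn time, the next value of the jump
chain is drawn from the jump kernel. -/
theorem HasMarkovProp.lintegral_next_value (h : HasMarkovProp P rho) (hlt : ∀ x, P x {x} < 1)
    {Q : Kernel X X} [IsMarkovKernel Q]
    (hQ : ∀ x, (P x).restrict {x}ᶜ = P x {x}ᶜ • Q x) (n : ℕ)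
    {Φ : (Fin (n + 1) → X × ℕ) × X → ℝ≥0∞} (hΦ : Measurable Φ) :
    ∫⁻ om, Φ (fun i => jumpTraj om i, om (jumpIdx om (n + 1))) ∂rho =
      ∫⁻ om, ∫⁻ y, Φ (fun i => jumpTraj om i, y) ∂Q (om (jumpIdx om n)) ∂rho := by
  have hev (k : ℕ) : Measurable fun om : ℕ → X => om (jumpIdx om k) :=
    measurable_eval_comp measurable_id (measurable_jumpIdx k)
  have hH : Measurable fun om : ℕ → X => fun i : Fin (n + 1) => jumpTraj om i :=
    measurable_pi_lambda _ fun i => (measurable_pi_apply _).comp measurable_jumpTraj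
  let H : ℕ → (ℕ → X) → Fin (n + 1) → X × ℕ := fun t om =>
    Function.update (fun i : Fin (n + 1) => jumpTraj om i) (Fin.last n)
      (om (jumpIdx om n), t + 1)
  have hHt (t : ℕ) : Measurable (H t) :=
    measurable_update'.comp (hH.prodMk ((hev n).prodMk measurable_const))
  have hH_dep (t : ℕ) (om om' : ℕ → X) (hJ : JumpsUpTo n om)
      (hag : ∀ i ≤ jumpIdx om n, om i = om' i) : H t om = H t om' := by
    ext1 i
    rcases eq_or_ne i (Fin.last n) with rfl | hi
    · simp only [H, Function.update_self]
      rw [hJ.jumpIdx_congr hag le_rfl, hag _ le_rfl]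
    · simp only [H, Function.update_of_ne hi, jumpTraj]
      have hin : (i : ℕ) < n := Fin.val_lt_last hi
      rw [hJ.jumpIdx_congr hag hin, hJ.jumpIdx_congr hag hin.le, hag _ (hJ.jumpIdx_le hin.le)]
  have hH_eq (t : ℕ) (om : ℕ → X) (ht : jumpIdx om (n + 1) = jumpIdx om n + (t + 1)) :
      H t om = fun i : Fin (n + 1) => jumpTraj om i := by
    refine Function.update_eq_self_iff.2 ?_
    simp [jumpTraj, ht]
  have hΦt (t : ℕ) : Measurable (Function.uncurry fun om y => Φ (H t om, y)) :=
    hΦ.comp (((hHt t).comp measurable_fst).prodMk measurable_snd)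
  have hΨ : Measurable fun p : (Fin (n + 1) → X × ℕ) × X => ∫⁻ y, Φ (p.1, y) ∂Q p.2 := by
    have : Measurable fun r : ((Fin (n + 1) → X × ℕ) × X) × X => Φ (r.1.1, r.2) :=
      hΦ.comp ((measurable_fst.comp measurable_fst).prodMk measurable_snd)
    exact this.lintegral_kernel_prod_right' (κ := Q.comap Prod.snd measurable_snd)
  refine (h.lintegral_eq_tsum_sojourn hlt n (hΦ.comp (hH.prodMk (hev (n + 1))))).trans
    (Eq.trans ?_ (h.lintegral_eq_tsum_sojourn hlt n (hΨ.comp (hH.prodMk (hev n)))).symm)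
  refine tsum_congr fun t => ?_
  have h1 := h.lintegral_sojourn hlt n t (hΦt t) fun om om' hJ hag => by rw [hH_dep t om om' hJ hag]
  have h2 := h.lintegral_sojourn hlt n t
    (f := fun om _ => ∫⁻ y, Φ (H t om, y) ∂Q (om (jumpIdx om n)))
    ((hΨ.comp ((hHt t).prodMk (hev n))).comp measurable_fst)
    fun om om' hJ hag => by
      rw [hH_dep t om om' hJ hag, hJ.jumpIdx_congr hag le_rfl, hag _ le_rfl]
  refine Eq.trans ?_ ((h1.trans ?_).trans (h2.symm.trans ?_))
  · refine lintegral_congr fun om => congrFun (Set.indicator_congr fun om hom => ?_) om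
    rw [hH_eq t om hom]
    rfl
  · congr with om
    rw [setLIntegral_const, hQ, lintegral_smul_measure, smul_eq_mul, mul_comm (P _ _)]
  · refine lintegral_congr fun om => congrFun (Set.indicator_congr fun om hom => ?_) om
    rw [hH_eq t om hom]
    rfl

theorem HasMarkovProp.map_jumpTraj (h : HasMarkovProp P rho) (hlt : ∀ x, P x {x} < 1)
    {Q : Kernel X X} [IsMarkovKernel Q]
    (hQ : ∀ x, (P x).restrict {x}ᶜ = P x {x}ᶜ • Q x)
    {G : Kernel X ℕ} [IsMarkovKernel G]
    (hG : ∀ x, ∀ g : ℕ → ℝ≥0∞, ∫⁻ k, g k ∂G x = ∑' t, P x {x} ^ t * P x {x}ᶜ * g (t + 1))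
    {Pb : Kernel (X × ℕ) (X × ℕ)} [IsMarkovKernel Pb]
    (hPb : ∀ p, ∀ F : X × ℕ → ℝ≥0∞, Measurable F →
      ∫⁻ z, F z ∂Pb p = ∫⁻ y, ∫⁻ k, F (y, k) ∂G y ∂Q p.1) :
    HasMarkovProp Pb (rho.map fun om => jumpTraj om) := by
  intro n
  have hev (k : ℕ) : Measurable fun om : ℕ → X => om (jumpIdx om k) :=
    measurable_eval_comp measurable_id (measurable_jumpIdx k)
  have hres : Measurable fun om : ℕ → X × ℕ => fun i : Fin (n + 1) => om i :=
    measurable_pi_lambda _ fun i => measurable_pi_apply _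
  have hH : Measurable fun om : ℕ → X => fun i : Fin (n + 1) => jumpTraj om i :=
    hres.comp measurable_jumpTraj
  have : IsProbabilityMeasure (rho.map fun om => jumpTraj om) :=
    Measure.isProbabilityMeasure_map measurable_jumpTraj.aemeasurable
  refine Measure.ext_of_lintegral _ fun F hF => ?_
  have hFG : Measurable fun p : (Fin (n + 1) → X × ℕ) × X =>
      ∫⁻ k, F (p.1, (p.2, k)) ∂G p.2 := by
    have : Measurable fun r : ((Fin (n + 1) → X × ℕ) × X) × ℕ => F (r.1.1, (r.1.2, r.2)) :=
      hF.comp (by fun_prop)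
    exact this.lintegral_kernel_prod_right' (κ := G.comap Prod.snd measurable_snd)
  have hFt (t : ℕ) : Measurable fun om : ℕ → X =>
      F (fun i => jumpTraj om i, (om (jumpIdx om (n + 1)), t + 1)) :=
    hF.comp (hH.prodMk ((hev (n + 1)).prodMk measurable_const))
  have hF₁ : Measurable fun om : ℕ → X × ℕ => F (fun i : Fin (n + 1) => om i, om (n + 1)) :=
    hF.comp (hres.prodMk (measurable_pi_apply _))
  have hF₂ : Measurable fun v : Fin (n + 1) → X × ℕ => ∫⁻ z, F (v, z) ∂Pb (v (Fin.last n)) :=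
    hF.lintegral_kernel_prod_right'
      (κ := Pb.comap (fun v : Fin (n + 1) → X × ℕ => v (Fin.last n)) (measurable_pi_apply _))
  have hF₃ : Measurable fun om : ℕ → X × ℕ =>
      ∫⁻ z, F (fun i : Fin (n + 1) => om i, z) ∂Pb (om n) :=
    hF₂.comp hres
  rw [lintegral_map hF (hres.prodMk (measurable_pi_apply _)), lintegral_map hF₁ measurable_jumpTraj,
    Measure.lintegral_compProd hF]
  simp only [Kernel.comap_apply]
  rw [lintegral_map hF₂ hres]
  simp only [Fin.val_last]
  rw [lintegral_map hF₃ measurable_jumpTraj]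
  refine (h.lintegral_eq_tsum_sojourn hlt (n + 1) (hF₁.comp measurable_jumpTraj)).trans ?_
  calc _ = ∑' t, ∫⁻ om, P (om (jumpIdx om (n + 1))) {om (jumpIdx om (n + 1))} ^ t *
            P (om (jumpIdx om (n + 1))) {om (jumpIdx om (n + 1))}ᶜ *
            F (fun i => jumpTraj om i, (om (jumpIdx om (n + 1)), t + 1)) ∂rho := by
        refine tsum_congr fun t => ?_
        have h1 := h.lintegral_sojourn hlt (n + 1) t
          (f := fun om _ => F (fun i => jumpTraj om i, (om (jumpIdx om (n + 1)), t + 1)))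
          ((hFt t).comp measurable_fst) fun om om' hJ hag => by
            have hi (i : Fin (n + 1)) : jumpTraj om i = jumpTraj om' i := by
              have hin : (i : ℕ) + 1 ≤ n + 1 := i.2
              simp only [jumpTraj]
              rw [hJ.jumpIdx_congr hag hin, hJ.jumpIdx_congr hag (by omega : (i : ℕ) ≤ n + 1),
                hag _ (hJ.jumpIdx_le (by omega))]
            simp only [hi]
            rw [hJ.jumpIdx_congr hag le_rfl, hag _ le_rfl]
        refine Eq.trans ?_ (h1.trans ?_)
        · refine lintegral_congr fun om => congrFun (Set.indicator_congr fun om hom => ?_) om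
          have hom : jumpIdx om (n + 1 + 1) = jumpIdx om (n + 1) + (t + 1) := hom
          simp [jumpTraj, hom]
        · congr with om
          rw [setLIntegral_const, mul_assoc, mul_comm (F _)]
    _ = ∫⁻ om, ∫⁻ k, F (fun i => jumpTraj om i, (om (jumpIdx om (n + 1)), k))
          ∂G (om (jumpIdx om (n + 1))) ∂rho := by
        rw [← lintegral_tsum]
        · simp only [hG]
        · intro t
          exact ((((Kernel.measurable_apply_singleton_self.comp (hev (n + 1))).pow_const t).mul
            (Kernel.measurable_apply_compl_singleton_self.comp (hev (n + 1)))).mul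
            (hFt t)).aemeasurable
    _ = ∫⁻ om, ∫⁻ y, ∫⁻ k, F (fun i => jumpTraj om i, (y, k)) ∂G y
          ∂Q (om (jumpIdx om n)) ∂rho :=
        h.lintegral_next_value hlt hQ n hFG
    _ = _ := by
        congr with om
        exact (hPb (jumpTraj om n) (fun z => F (fun i => jumpTraj om i, z))
          (hF.comp measurable_prodMk_left)).symm

end JumpChain

section Reversibility

variable {κ : Kernel X X} {mu : Measure X}

theorem reversible_iff_lintegral [IsSFiniteKernel κ] [SFinite mu] :
    Reversible κ mu ↔ ∀ F : X × X → ℝ≥0∞, Measurable F →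
      ∫⁻ x, ∫⁻ y, F (y, x) ∂κ x ∂mu = ∫⁻ x, ∫⁻ y, F (x, y) ∂κ x ∂mu := by
  have key (F : X × X → ℝ≥0∞) (hF : Measurable F) :
      ∫⁻ p, F p ∂(mu.compProd κ).map Prod.swap = ∫⁻ x, ∫⁻ y, F (y, x) ∂κ x ∂mu := by
    rw [lintegral_map hF measurable_swap]
    exact Measure.lintegral_compProd (hF.comp measurable_swap)
  constructor
  · intro h F hF
    rw [← key F hF, h, Measure.lintegral_compProd hF]
  · intro h
    refine Measure.ext_of_lintegral _ fun F hF => ?_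
    rw [key F hF, Measure.lintegral_compProd hF, h F hF]

theorem Reversible.lintegral_lintegral [IsMarkovKernel κ] [SFinite mu] (h : Reversible κ mu)
    {f : X → ℝ≥0∞} (hf : Measurable f) : ∫⁻ x, ∫⁻ y, f y ∂κ x ∂mu = ∫⁻ x, f x ∂mu := by
  simpa using reversible_iff_lintegral.1 h (fun p => f p.1) (hf.comp measurable_fst)

theorem Reversible.lintegral_kpow [IsMarkovKernel κ] [SFinite mu] (h : Reversible κ mu)
    {A : Set X} (hA : MeasurableSet A) (n : ℕ) : ∫⁻ x, kpow κ n x A ∂mu = mu A := by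
  induction n with
  | zero =>
    simp only [kpow, Kernel.id_apply, Measure.dirac_apply' _ hA]
    rw [lintegral_indicator_one hA]
  | succ n ih =>
    simp only [kpow, Kernel.comp_apply' _ _ _ hA]
    rw [h.lintegral_lintegral ((kpow κ n).measurable_coe hA), ih]

theorem kpow_apply_of_eq_dirac {x : X} (hx : κ x = Measure.dirac x) (n : ℕ) :
    kpow κ n x = Measure.dirac x := by
  induction n with
  | zero => simp [kpow, Kernel.id_apply]
  | succ n ih => rw [kpow, Kernel.comp_apply, hx, Measure.dirac_bind (kpow κ n).measurable, ih]

theorem Reversible.measure_singleton_eq_one [MeasurableSingletonClass X] [IsMarkovKernel κ]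
    [IsProbabilityMeasure mu] (h : Reversible κ mu) (hirr : PsiIrreducible κ) {x₀ : X}
    (hx₀ : κ x₀ = Measure.dirac x₀) : mu {x₀} = 1 := by
  obtain ⟨psi, hpsi, -, hreach⟩ := hirr
  have hm : MeasurableSet {x₀} := measurableSet_singleton x₀
  have hcompl : psi {x₀}ᶜ = 0 := by
    by_contra hne
    obtain ⟨n, -, hn⟩ := hreach x₀ _ hm.compl (pos_iff_ne_zero.2 hne)
    rw [kpow_apply_of_eq_dirac hx₀, Measure.dirac_apply' _ hm.compl] at hn
    simp at hn
  have hpos : 0 < psi {x₀} := by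
    refine pos_iff_ne_zero.2 fun h0 => hpsi (Measure.measure_univ_eq_zero.1 ?_)
    rw [← measure_add_measure_compl hm, h0, hcompl, add_zero]
  have hnull (n : ℕ) : ∀ᵐ x ∂mu.restrict {x₀}ᶜ, kpow κ n x {x₀} = 0 := by
    have hmeas : Measurable fun x => kpow κ n x {x₀} := (kpow κ n).measurable_coe hm
    have hsplit := lintegral_add_compl (μ := mu) (fun x => kpow κ n x {x₀}) hm
    rw [h.lintegral_kpow hm, lintegral_singleton, kpow_apply_of_eq_dirac hx₀,
      Measure.dirac_apply' _ hm] at hsplit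
    have h0 : ∫⁻ x in {x₀}ᶜ, kpow κ n x {x₀} ∂mu = 0 := by
      have h1 : mu {x₀} + ∫⁻ x in {x₀}ᶜ, kpow κ n x {x₀} ∂mu = mu {x₀} + 0 := by
        simpa using hsplit
      exact (ENNReal.add_right_inj (measure_ne_top _ _)).1 h1
    exact (lintegral_eq_zero_iff hmeas).1 h0
  have hfalse : ∀ᵐ x ∂mu.restrict {x₀}ᶜ, False := by
    filter_upwards [ae_all_iff.2 hnull] with x hx
    obtain ⟨n, -, hn⟩ := hreach x _ hm hpos
    exact hn.ne' (hx n)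
  rw [ae_iff] at hfalse
  exact (prob_compl_eq_zero_iff hm).1 (by simpa using hfalse)

theorem Reversible.jump [MeasurableEq X] [IsMarkovKernel κ] [IsFiniteMeasure mu]
    (h : Reversible κ mu) {Q : Kernel X X} [IsMarkovKernel Q]
    (hQ : ∀ x, (κ x).restrict {x}ᶜ = κ x {x}ᶜ • Q x) (c : ℝ≥0∞)
    [SFinite (c • mu.withDensity fun x => κ x {x}ᶜ)] :
    Reversible Q (c • mu.withDensity fun x => κ x {x}ᶜ) := by
  have key (F : X × X → ℝ≥0∞) (hF : Measurable F) :
      ∫⁻ x, ∫⁻ y, F (x, y) ∂Q x ∂(c • mu.withDensity fun x => κ x {x}ᶜ) =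
        c * ∫⁻ x, ∫⁻ y, (Set.diagonal X)ᶜ.indicator F (x, y) ∂κ x ∂mu := by
    rw [lintegral_smul_measure, smul_eq_mul, lintegral_withDensity_eq_lintegral_mul _
      Kernel.measurable_apply_compl_singleton_self hF.lintegral_kernel_prod_right']
    congr 2 with x
    have hx : (fun y => (Set.diagonal X)ᶜ.indicator F (x, y)) =
        ({x}ᶜ : Set X).indicator fun y => F (x, y) := by
      classical
      ext y
      simp [Set.indicator_apply, eq_comm]
    rw [hx, lintegral_indicator (measurableSet_singleton x).compl, hQ, lintegral_smul_measure]
    rfl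
  refine reversible_iff_lintegral.2 fun F hF => ?_
  rw [key F hF, ← reversible_iff_lintegral.1 h _ (hF.indicator measurableSet_diagonal.compl)]
  refine (key (fun p => F p.swap) (hF.comp measurable_swap)).trans ?_
  congr 4 with x
  congr 1 with y
  classical
  simp [Set.indicator_apply, eq_comm]

theorem Reversible.marked [IsSFiniteKernel κ] [SFinite mu] (h : Reversible κ mu)
    {G : Kernel X ℕ} [IsMarkovKernel G]
    {Pb : Kernel (X × ℕ) (X × ℕ)} [IsSFiniteKernel Pb]
    (hPb : ∀ p, ∀ F : X × ℕ → ℝ≥0∞, Measurable F →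
      ∫⁻ z, F z ∂Pb p = ∫⁻ y, ∫⁻ k, F (y, k) ∂G y ∂κ p.1)
    {mb : Measure (X × ℕ)} [SFinite mb]
    (hmb : ∀ F : X × ℕ → ℝ≥0∞, Measurable F → ∫⁻ z, F z ∂mb = ∫⁻ x, ∫⁻ k, F (x, k) ∂G x ∂mu) :
    Reversible Pb mb := by
  have hint (F : (X × ℕ) × (X × ℕ) → ℝ≥0∞) (hF : Measurable F) :
      Measurable fun p : X × X => ∫⁻ j, ∫⁻ k, F ((p.1, j), (p.2, k)) ∂G p.2 ∂G p.1 := by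
    have h1 : Measurable fun r : (X × X) × ℕ => ∫⁻ k, F ((r.1.1, r.2), (r.1.2, k)) ∂G r.1.2 := by
      have : Measurable fun r : ((X × X) × ℕ) × ℕ => F ((r.1.1.1, r.1.2), (r.1.1.2, r.2)) :=
        hF.comp (by fun_prop)
      exact this.lintegral_kernel_prod_right' (κ := G.comap (fun r : (X × X) × ℕ => r.1.2)
        (by fun_prop))
    exact h1.lintegral_kernel_prod_right' (κ := G.comap Prod.fst measurable_fst)
  have key (F : (X × ℕ) × (X × ℕ) → ℝ≥0∞) (hF : Measurable F) :
      ∫⁻ z, ∫⁻ w, F (z, w) ∂Pb z ∂mb =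
        ∫⁻ x, ∫⁻ y, ∫⁻ j, ∫⁻ k, F ((x, j), (y, k)) ∂G y ∂G x ∂κ x ∂mu := by
    rw [hmb _ hF.lintegral_kernel_prod_right']
    congr with x
    have h1 : Measurable fun r : ℕ × X => ∫⁻ k, F ((x, r.1), (r.2, k)) ∂G r.2 := by
      have : Measurable fun s : (ℕ × X) × ℕ => F ((x, s.1.1), (s.1.2, s.2)) :=
        hF.comp (by fun_prop)
      exact this.lintegral_kernel_prod_right' (κ := G.comap Prod.snd measurable_snd)
    rw [← lintegral_lintegral_swap h1.aemeasurable]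
    congr with j
    exact hPb (x, j) _ (hF.comp measurable_prodMk_left)
  refine reversible_iff_lintegral.2 fun F hF => ?_
  rw [key F hF, ← reversible_iff_lintegral.1 h _ (hint F hF)]
  refine (key (fun p => F p.swap) (hF.comp measurable_swap)).trans ?_
  congr with x
  congr with y
  refine lintegral_lintegral_swap (Measurable.aemeasurable ?_)
  exact hF.comp (by fun_prop)

end Reversibility

section MetropolisHastings

theorem lintegral_geomMeasure (u : ℝ) (g : ℕ → ℝ≥0∞) :
    ∫⁻ k, g k ∂geomMeasure u = ∑' k, ENNReal.ofReal (u * (1 - u) ^ k) * g (k + 1) := by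
  simp [geomMeasure, lintegral_sum_measure]

theorem isProbabilityMeasure_geomMeasure {u : ℝ} (hu0 : 0 < u) (hu1 : u ≤ 1) :
    IsProbabilityMeasure (geomMeasure u) := by
  constructor
  have hr0 : 0 ≤ 1 - u := by linarith
  have hs : HasSum (fun k : ℕ => u * (1 - u) ^ k) 1 := by
    have := (hasSum_geometric_of_lt_one hr0 (by linarith)).mul_left u
    rwa [sub_sub_cancel, mul_inv_cancel₀ hu0.ne'] at this
  have h1 := lintegral_geomMeasure u 1
  simp only [Pi.one_apply, lintegral_one, mul_one] at h1
  rw [h1, ← ENNReal.ofReal_tsum_of_nonneg (fun k => by positivity) hs.summable, hs.tsum_eq,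
    ENNReal.ofReal_one]

theorem measurable_geomMeasure : Measurable geomMeasure := by
  refine Measure.measurable_of_measurable_coe _ fun s hs => ?_
  have (u : ℝ) := lintegral_geomMeasure u (s.indicator 1)
  simp only [lintegral_indicator_one hs] at this
  simp only [this]
  fun_prop

variable {q : Kernel X X} {alpha : X → X → ℝ}

theorem measurable_rhoMH [IsMarkovKernel q] (ha : Measurable fun p : X × X => alpha p.1 p.2) :
    Measurable (rhoMH q alpha) :=
  (StronglyMeasurable.integral_kernel_prod_right' (κ := q) ha.stronglyMeasurable).measurable

theorem rhoMH_mem_Icc [IsMarkovKernel q] (h01 : ∀ x y, alpha x y ∈ Set.Icc (0 : ℝ) 1) (x : X) :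
    rhoMH q alpha x ∈ Set.Icc (0 : ℝ) 1 := by
  refine ⟨integral_nonneg fun y => (h01 x y).1, ?_⟩
  have := integral_mono_of_nonneg (μ := q x) (Eventually.of_forall fun y => (h01 x y).1)
    (integrable_const (1 : ℝ)) (Eventually.of_forall fun y => (h01 x y).2)
  simpa [rhoMH] using this

theorem withDensity_accept_univ [IsMarkovKernel q]
    (ha : Measurable fun p : X × X => alpha p.1 p.2)
    (h01 : ∀ x y, alpha x y ∈ Set.Icc (0 : ℝ) 1) (x : X) :
    (q x).withDensity (fun y => ENNReal.ofReal (alpha x y)) Set.univ =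
      ENNReal.ofReal (rhoMH q alpha x) := by
  have hax : Measurable (alpha x) := ha.comp measurable_prodMk_left
  rw [withDensity_apply _ .univ, Measure.restrict_univ, rhoMH,
    ofReal_integral_eq_lintegral_ofReal _ (Eventually.of_forall fun y => (h01 x y).1)]
  refine Integrable.of_bound hax.aestronglyMeasurable 1 (Eventually.of_forall fun y => ?_)
  rw [Real.norm_of_nonneg (h01 x y).1]
  exact (h01 x y).2

theorem withDensity_accept_singleton [MeasurableSingletonClass X] (hq : ∀ x, q x {x} = 0) (x : X) :
    (q x).withDensity (fun y => ENNReal.ofReal (alpha x y)) {x} = 0 :=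
  withDensity_absolutelyContinuous _ _ (hq x)

theorem mhMeasure_singleton [MeasurableSingletonClass X] (hq : ∀ x, q x {x} = 0) (x : X) :
    mhMeasure q alpha x {x} = ENNReal.ofReal (1 - rhoMH q alpha x) := by
  simp [mhMeasure, withDensity_accept_singleton hq]

theorem mhMeasure_restrict_compl_singleton [MeasurableSingletonClass X] (hq : ∀ x, q x {x} = 0)
    (x : X) : (mhMeasure q alpha x).restrict {x}ᶜ =
      (q x).withDensity (fun y => ENNReal.ofReal (alpha x y)) := by
  have hd : (Measure.dirac x).restrict {x}ᶜ = 0 := by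
    rw [Measure.restrict_eq_zero, Measure.dirac_apply' _ (measurableSet_singleton x).compl]
    simp
  rw [mhMeasure, Measure.restrict_add, Measure.restrict_smul, hd, smul_zero, add_zero,
    Measure.restrict_eq_self_of_ae_mem]
  rw [ae_iff]
  simpa using withDensity_accept_singleton hq x

theorem mhMeasure_compl_singleton [MeasurableSingletonClass X] [IsMarkovKernel q]
    (hq : ∀ x, q x {x} = 0) (ha : Measurable fun p : X × X => alpha p.1 p.2)
    (h01 : ∀ x y, alpha x y ∈ Set.Icc (0 : ℝ) 1) (x : X) :
    mhMeasure q alpha x {x}ᶜ = ENNReal.ofReal (rhoMH q alpha x) := by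
  rw [← withDensity_accept_univ ha h01, ← mhMeasure_restrict_compl_singleton hq,
    Measure.restrict_apply_univ]

end MetropolisHastings

/-- (the jump chain representation of a Metropolis–Hastings type chain:
positivity of the acceptance rate, Markov property of the jump chain with kernel `P̄`,
and reversibility of `P̄` w.r.t. `μ̄` and of `P̃` w.r.t. `μ̃`). -/
theorem statement_2 {n : ℕ}
    (q : Kernel (Fin n → ℝ) (Fin n → ℝ)) [IsMarkovKernel q]
    (hqnodiag : ∀ x, q x {x} = 0)
    (alpha : (Fin n → ℝ) → (Fin n → ℝ) → ℝ)
    (halpham : Measurable fun p : (Fin n → ℝ) × (Fin n → ℝ) => alpha p.1 p.2)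
    (halpha01 : ∀ x y, alpha x y ∈ Set.Icc (0 : ℝ) 1)
    (P : Kernel (Fin n → ℝ) (Fin n → ℝ)) [IsMarkovKernel P]
    (hP : ∀ x, P x = mhMeasure q alpha x)
    (mu : Measure (Fin n → ℝ)) [IsProbabilityMeasure mu]
    (hrev : Reversible P mu)
    (hnotpoint : ¬ ∃ x, mu {x} = 1)
    (hirr : PsiIrreducible P)
    (Ptilde : Kernel (Fin n → ℝ) (Fin n → ℝ))
    (hPtilde : ∀ x, Ptilde x = jumpMeasure q alpha x)
    (Pbar : Kernel ((Fin n → ℝ) × ℕ) ((Fin n → ℝ) × ℕ))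
    (hPbar : ∀ p : (Fin n → ℝ) × ℕ,
      Pbar p = (Ptilde p.1).bind
        (fun y => (Measure.dirac y).prod (geomMeasure (rhoMH q alpha y)))) :
    (∀ x, 0 < rhoMH q alpha x) ∧
    (∀ rho : Measure (ℕ → (Fin n → ℝ)), IsMarkovTraj P mu rho →
      HasMarkovProp Pbar (rho.map (fun om => jumpTraj om))) ∧
    Reversible Pbar (muBar mu (rhoMH q alpha)) ∧
    Reversible Ptilde (muTilde mu (rhoMH q alpha)) := by
  have hm := rhoMH_mem_Icc (q := q) halpha01
  have hmeas := measurable_rhoMH (q := q) halpham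
  have hstay (x) : P x {x} = ENNReal.ofReal (1 - rhoMH q alpha x) := by
    rw [hP, mhMeasure_singleton hqnodiag]
  have hmove (x) : P x {x}ᶜ = ENNReal.ofReal (rhoMH q alpha x) := by
    rw [hP, mhMeasure_compl_singleton hqnodiag halpham halpha01]
  have hpos (x) : 0 < rhoMH q alpha x := by
    refine (hm x).1.lt_of_ne fun h0 => hnotpoint ⟨x, hrev.measure_singleton_eq_one hirr ?_⟩
    have hz : (q x).withDensity (fun y => ENNReal.ofReal (alpha x y)) = 0 := by
      rw [← Measure.measure_univ_eq_zero, withDensity_accept_univ halpham halpha01, ← h0,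
        ENNReal.ofReal_zero]
    rw [hP, mhMeasure, hz, ← h0]
    simp
  have hne0 (x) : ENNReal.ofReal (rhoMH q alpha x) ≠ 0 := (ENNReal.ofReal_pos.2 (hpos x)).ne'
  have : IsMarkovKernel Ptilde := ⟨fun x => ⟨by
    rw [hPtilde, jumpMeasure, Measure.smul_apply, withDensity_accept_univ halpham halpha01,
      smul_eq_mul, ENNReal.inv_mul_cancel (hne0 x) ENNReal.ofReal_ne_top]⟩⟩
  have hQ (x) : (P x).restrict {x}ᶜ = P x {x}ᶜ • Ptilde x := by
    rw [hmove, hPtilde, jumpMeasure, smul_smul,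
      ENNReal.mul_inv_cancel (hne0 x) ENNReal.ofReal_ne_top, one_smul, hP,
      mhMeasure_restrict_compl_singleton hqnodiag]
  let G : Kernel (Fin n → ℝ) ℕ :=
    ⟨fun x => geomMeasure (rhoMH q alpha x), measurable_geomMeasure.comp hmeas⟩
  have : IsMarkovKernel G := ⟨fun x => isProbabilityMeasure_geomMeasure (hpos x) (hm x).2⟩
  have hG (x) (g : ℕ → ℝ≥0∞) :
      ∫⁻ k, g k ∂G x = ∑' t, P x {x} ^ t * P x {x}ᶜ * g (t + 1) := by
    refine (lintegral_geomMeasure _ g).trans (tsum_congr fun t => ?_)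
    rw [hstay, hmove, ENNReal.ofReal_mul (hm x).1, ENNReal.ofReal_pow (by linarith [(hm x).2]),
      mul_comm (ENNReal.ofReal (rhoMH q alpha x))]
  have hmark (m : Measure (Fin n → ℝ)) (F : (Fin n → ℝ) × ℕ → ℝ≥0∞) (hF : Measurable F) :
      ∫⁻ z, F z ∂m.bind (fun y => (Measure.dirac y).prod (geomMeasure (rhoMH q alpha y))) =
        ∫⁻ y, ∫⁻ k, F (y, k) ∂G y ∂m := by
    have hK (y) : (Kernel.id ×ₖ G) y =
        (Measure.dirac y).prod (geomMeasure (rhoMH q alpha y)) := by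
      rw [Kernel.prod_apply, Kernel.id_apply]
      rfl
    simp only [← hK]
    rw [Measure.lintegral_bind (Kernel.aemeasurable _) hF.aemeasurable]
    congr with y
    rw [Kernel.lintegral_id_prod hF]
  have hPb (p) (F : (Fin n → ℝ) × ℕ → ℝ≥0∞) (hF : Measurable F) :
      ∫⁻ z, F z ∂Pbar p = ∫⁻ y, ∫⁻ k, F (y, k) ∂G y ∂Ptilde p.1 := by
    rw [hPbar, hmark _ F hF]
  have : IsMarkovKernel Pbar := ⟨fun p => ⟨by simpa using hPb p 1 measurable_one⟩⟩
  have hmt : muTilde mu (rhoMH q alpha) =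
      (ENNReal.ofReal (∫ x, rhoMH q alpha x ∂mu))⁻¹ • mu.withDensity fun x => P x {x}ᶜ := by
    simp only [muTilde, hmove]
  have hrevt : Reversible Ptilde (muTilde mu (rhoMH q alpha)) := by
    rw [hmt]
    exact hrev.jump hQ _
  have : SFinite (muTilde mu (rhoMH q alpha)) := by
    rw [hmt]
    infer_instance
  have : SFinite (muBar mu (rhoMH q alpha)) := by
    have : muBar mu (rhoMH q alpha) = (muTilde mu (rhoMH q alpha)).compProd G := by
      refine Measure.ext_of_lintegral _ fun F hF => ?_
      rw [Measure.lintegral_compProd hF, muBar, hmark _ F hF]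
    rw [this]
    infer_instance
  refine ⟨hpos, fun rho hrho => ?_, hrevt.marked hPb fun F hF => hmark _ F hF, hrevt⟩
  have := hrho.1
  refine HasMarkovProp.map_jumpTraj hrho.2.2 (fun x => ?_) hQ hG hPb
  rw [hstay, ENNReal.ofReal_lt_one]
  linarith [hpos x]
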